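/- Let K=⟨T,A⟩ be a satisfiable normalised ELHO knowledge base, let q=∃y.ψ(x,y) be a conjunctive query, and let π be a candidate answer for q mapping the answer variables x to named individuals. Then Ξ(K)⊨π(q) if and only if there exists a substitution τ with domain x∪y such that τ restricted to x equals π, dat(K)⊨τ(q), and isSpurious(q,dat(K),τ)=false. -/

import Mathlib

namespace ELHO

variable {C R V Ind : Type}

/-- Unary predicates: atomic concepts, ⊤ and ⊥. -/
inductive UPred (C : Type) where
  | conc : C → UPred C
  | top : UPred C
  | bot : UPred C

/-- Concepts that are either atomic (`some A`) or ⊤ (`none`). -/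
abbrev CT (C : Type) := Option C

/-- View a concept-or-⊤ as a unary predicate. -/
def ctU : CT C → UPred C
  | some A => .conc A
  | none => .top

def UPred.clist : UPred C → List C
  | .conc A => [A]
  | _ => []

/-- Normalised ELHO TBox axioms (Table 1). -/
inductive Ax (C R Ind : Type) where
  | nom : Ind → CT C → Ax C R Ind              -- {a} ⊑ A
  | sub : CT C → UPred C → Ax C R Ind          -- A ⊑ B
  | subNom : CT C → Ind → Ax C R Ind           -- A ⊑ {a}
  | conj : CT C → CT C → CT C → Ax C R Ind     -- A1 ⊓ A2 ⊑ A
  | exSub : R → CT C → CT C → Ax C R Ind       -- ∃R.A1 ⊑ A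
  | subEx : CT C → R → CT C → Ax C R Ind       -- A1 ⊑ ∃R.A
  | roleSub : R → R → Ax C R Ind               -- R ⊑ S
  | range : R → CT C → Ax C R Ind              -- ran(R) ⊑ A

/-- Atomic concepts occurring in an axiom. -/
def Ax.concepts : Ax C R Ind → List C
  | .nom _ A => A.toList
  | .sub A B => A.toList ++ B.clist
  | .subNom A _ => A.toList
  | .conj A1 A2 A => A1.toList ++ A2.toList ++ A.toList
  | .exSub _ A1 A => A1.toList ++ A.toList
  | .subEx A1 _ A => A1.toList ++ A.toList
  | .roleSub _ _ => []
  | .range _ A => A.toList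

/-- Roles occurring in an axiom. -/
def Ax.roles : Ax C R Ind → List R
  | .nom _ _ => []
  | .sub _ _ => []
  | .subNom _ _ => []
  | .conj _ _ _ => []
  | .exSub S _ _ => [S]
  | .subEx _ S _ => [S]
  | .roleSub S S' => [S, S']
  | .range S _ => [S]

/-- ABox assertions: ground facts over individuals. -/
inductive AFact (C R Ind : Type) where
  | unary : UPred C → Ind → AFact C R Ind
  | role : R → Ind → Ind → AFact C R Ind

/-- A normalised ELHO knowledge base K = ⟨T,A⟩. -/
structure KB (C R Ind : Type) where
  tbox : List (Ax C R Ind)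
  abox : List (AFact C R Ind)

/-- Terms of the Herbrand universe of Ξ(K): individuals and terms built with
    the unary function symbols `f_{R,A}`. -/
inductive XTerm (C R Ind : Type) where
  | ind : Ind → XTerm C R Ind
  | fn : R → CT C → XTerm C R Ind → XTerm C R Ind

/-- Terms of the Herbrand universe of dat(K): individuals and the auxiliary
    individuals `o_{R,A}`. -/
inductive DTerm (C R Ind : Type) where
  | ind : Ind → DTerm C R Ind
  | aux : R → CT C → DTerm C R Ind

/-- The mapping δ: δ(a) = a and δ(f_{R,A}(w')) = o_{R,A}. -/
def δ : XTerm C R Ind → DTerm C R Ind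
  | .ind a => .ind a
  | .fn S A _ => .aux S A

/-- Ground facts over a term type `T`. -/
inductive Fact (C R T : Type) where
  | unary : UPred C → T → Fact C R T
  | role : R → T → T → Fact C R T
  | eq : T → T → Fact C R T

/-- `t` occurs in the fact (any predicate, including ≈). -/
def occursF {T : Type} (t : T) : Fact C R T → Prop
  | .unary _ s => s = t
  | .role _ s s' => s = t ∨ s' = t
  | .eq s s' => s = t ∨ s' = t

/-- `t` occurs in the fact and the fact is not an ≈-fact. -/
def occursNE {T : Type} (t : T) : Fact C R T → Prop
  | .unary _ s => s = t
  | .role _ s s' => s = t ∨ s' = t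
  | .eq _ _ => False

/-- N_I(H): terms occurring in the model `H` in at least one non-≈ fact. -/
def NI {T : Type} (H : Fact C R T → Prop) (t : T) : Prop := ∃ f, H f ∧ occursNE t f

/-- `t` occurs in the model `H` (in any fact). -/
def occursM {T : Type} (H : Fact C R T → Prop) (t : T) : Prop := ∃ f, H f ∧ occursF t f

/-- aux(H): 'true' auxiliary terms of a Herbrand model `H`, i.e. the terms of
    N_I(H) that are ≈-equal to no named individual (`ι` injects the named
    individuals into the term type). -/
def auxT {T : Type} (H : Fact C R T → Prop) (ι : Ind → T) (t : T) : Prop :=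
  NI H t ∧ ∀ a : Ind, ¬ H (.eq t (ι a))

/-- The minimal Herbrand model of Ξ(K) (with the equality axiomatisation),
    defined as the least set of ground facts closed under all clauses of
    Ξ(K) ∪ Ξ(K)_≈. -/
inductive XI (K : KB C R Ind) : Fact C R (XTerm C R Ind) → Prop where
  | abU {B a} : AFact.unary B a ∈ K.abox → XI K (.unary B (.ind a))
  | abR {S a b} : AFact.role S a b ∈ K.abox → XI K (.role S (.ind a) (.ind b))
  | nom {a A} : Ax.nom a A ∈ K.tbox → XI K (.unary (ctU A) (.ind a))
  | sub {A B w} : Ax.sub A B ∈ K.tbox → XI K (.unary (ctU A) w) → XI K (.unary B w)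
  | subNom {A a w} : Ax.subNom A a ∈ K.tbox → XI K (.unary (ctU A) w) →
      XI K (.eq w (.ind a))
  | conj {A1 A2 A w} : Ax.conj A1 A2 A ∈ K.tbox → XI K (.unary (ctU A1) w) →
      XI K (.unary (ctU A2) w) → XI K (.unary (ctU A) w)
  | exSub {S A1 A w w'} : Ax.exSub S A1 A ∈ K.tbox → XI K (.role S w w') →
      XI K (.unary (ctU A1) w') → XI K (.unary (ctU A) w)
  | subEx1 {A1 S A w} : Ax.subEx A1 S A ∈ K.tbox → XI K (.unary (ctU A1) w) →
      XI K (.role S w (.fn S A w))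
  | subEx2 {A1 S A w} : Ax.subEx A1 S A ∈ K.tbox → XI K (.unary (ctU A1) w) →
      XI K (.unary (ctU A) (.fn S A w))
  | roleSub {S S' w w'} : Ax.roleSub S S' ∈ K.tbox → XI K (.role S w w') →
      XI K (.role S' w w')
  | range {S A w w'} : Ax.range S A ∈ K.tbox → XI K (.role S w w') →
      XI K (.unary (ctU A) w')
  | topU {A w} : A ∈ K.tbox.flatMap Ax.concepts → XI K (.unary (.conc A) w) →
      XI K (.unary .top w)
  | topR1 {S w w'} : S ∈ K.tbox.flatMap Ax.roles → XI K (.role S w w') →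
      XI K (.unary .top w)
  | topR2 {S w w'} : S ∈ K.tbox.flatMap Ax.roles → XI K (.role S w w') →
      XI K (.unary .top w')
  | refl {w f} : XI K f → occursF w f → XI K (.eq w w)
  | symm {w w'} : XI K (.eq w w') → XI K (.eq w' w)
  | trans {w1 w2 w3} : XI K (.eq w1 w2) → XI K (.eq w2 w3) → XI K (.eq w1 w3)
  | repU {B w w'} : XI K (.unary B w) → XI K (.eq w w') → XI K (.unary B w')
  | repR1 {S w1 w2 w'} : XI K (.role S w1 w2) → XI K (.eq w1 w') → XI K (.role S w' w2)
  | repR2 {S w1 w2 w'} : XI K (.role S w1 w2) → XI K (.eq w2 w') → XI K (.role S w1 w')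
  | repF {S A w w'} : XI K (.eq w w') → XI K (.eq (XTerm.fn S A w) (XTerm.fn S A w'))

/-- The minimal Herbrand model of dat(K) (with the equality axiomatisation). -/
inductive DM (K : KB C R Ind) : Fact C R (DTerm C R Ind) → Prop where
  | abU {B a} : AFact.unary B a ∈ K.abox → DM K (.unary B (.ind a))
  | abR {S a b} : AFact.role S a b ∈ K.abox → DM K (.role S (.ind a) (.ind b))
  | nom {a A} : Ax.nom a A ∈ K.tbox → DM K (.unary (ctU A) (.ind a))
  | sub {A B w} : Ax.sub A B ∈ K.tbox → DM K (.unary (ctU A) w) → DM K (.unary B w)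
  | subNom {A a w} : Ax.subNom A a ∈ K.tbox → DM K (.unary (ctU A) w) →
      DM K (.eq w (.ind a))
  | conj {A1 A2 A w} : Ax.conj A1 A2 A ∈ K.tbox → DM K (.unary (ctU A1) w) →
      DM K (.unary (ctU A2) w) → DM K (.unary (ctU A) w)
  | exSub {S A1 A w w'} : Ax.exSub S A1 A ∈ K.tbox → DM K (.role S w w') →
      DM K (.unary (ctU A1) w') → DM K (.unary (ctU A) w)
  | subEx1 {A1 S A w} : Ax.subEx A1 S A ∈ K.tbox → DM K (.unary (ctU A1) w) →
      DM K (.role S w (.aux S A))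
  | subEx2 {A1 S A w} : Ax.subEx A1 S A ∈ K.tbox → DM K (.unary (ctU A1) w) →
      DM K (.unary (ctU A) (.aux S A))
  | roleSub {S S' w w'} : Ax.roleSub S S' ∈ K.tbox → DM K (.role S w w') →
      DM K (.role S' w w')
  | range {S A w w'} : Ax.range S A ∈ K.tbox → DM K (.role S w w') →
      DM K (.unary (ctU A) w')
  | topU {A w} : A ∈ K.tbox.flatMap Ax.concepts → DM K (.unary (.conc A) w) →
      DM K (.unary .top w)
  | topR1 {S w w'} : S ∈ K.tbox.flatMap Ax.roles → DM K (.role S w w') →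
      DM K (.unary .top w)
  | topR2 {S w w'} : S ∈ K.tbox.flatMap Ax.roles → DM K (.role S w w') →
      DM K (.unary .top w')
  | refl {w f} : DM K f → occursF w f → DM K (.eq w w)
  | symm {w w'} : DM K (.eq w w') → DM K (.eq w' w)
  | trans {w1 w2 w3} : DM K (.eq w1 w2) → DM K (.eq w2 w3) → DM K (.eq w1 w3)
  | repU {B w w'} : DM K (.unary B w) → DM K (.eq w w') → DM K (.unary B w')
  | repR1 {S w1 w2 w'} : DM K (.role S w1 w2) → DM K (.eq w1 w') → DM K (.role S w' w2)
  | repR2 {S w1 w2 w'} : DM K (.role S w1 w2) → DM K (.eq w2 w') → DM K (.role S w1 w')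

/-- Terms of a conjunctive query: variables and individuals (constants). -/
inductive QTerm (V Ind : Type) where
  | var : V → QTerm V Ind
  | const : Ind → QTerm V Ind

/-- Function-free atoms of a conjunctive query. -/
inductive QAtom (C R V Ind : Type) where
  | unary : UPred C → QTerm V Ind → QAtom C R V Ind
  | role : R → QTerm V Ind → QTerm V Ind → QAtom C R V Ind

/-- A conjunctive query q = ∃y.ψ(x,y): a set of atoms together with the
    predicate selecting the answer variables x. -/
structure CQ (C R V Ind : Type) where
  answers : V → Prop
  atoms : List (QAtom C R V Ind)

/-- Extension of a substitution on variables to query terms. -/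
def QTerm.evalT {T : Type} (ι : Ind → T) (σ : V → T) : QTerm V Ind → T
  | .var v => σ v
  | .const a => ι a

/-- Application of a substitution to a query atom. -/
def QAtom.applyA {T : Type} (ι : Ind → T) (σ : V → T) : QAtom C R V Ind → Fact C R T
  | .unary B t => .unary B (t.evalT ι σ)
  | .role S s t => .role S (s.evalT ι σ) (t.evalT ι σ)

/-- terms(q). -/
def CQ.terms (q : CQ C R V Ind) : List (QTerm V Ind) :=
  q.atoms.flatMap fun a => match a with
    | .unary _ t => [t]
    | .role _ s t => [s, t]

/-- Ξ(K) ⊨ σ(q): every atom of q is mapped by σ into the minimal Herbrand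
    model of Ξ(K). -/
def holdsX (K : KB C R Ind) (q : CQ C R V Ind) (σ : V → XTerm C R Ind) : Prop :=
  ∀ a ∈ q.atoms, XI K (a.applyA XTerm.ind σ)

/-- dat(K) ⊨ τ(q). -/
def holdsD (K : KB C R Ind) (q : CQ C R V Ind) (τ : V → DTerm C R Ind) : Prop :=
  ∀ a ∈ q.atoms, DM K (a.applyA DTerm.ind τ)

/-- aux(dat(K)): the individuals u of dat(K) such that dat(K) ⊨ u ≈ c for no
    named individual c. -/
def auxDat (K : KB C R Ind) (u : DTerm C R Ind) : Prop :=
  ∀ a : Ind, ¬ DM K (.eq u (.ind a))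

/-- Extension of τ to the query terms (over dat(K)-terms). -/
def evalD (τ : V → DTerm C R Ind) : QTerm V Ind → DTerm C R Ind :=
  QTerm.evalT DTerm.ind τ

/-- Extension of π* to the query terms (over Ξ(K)-terms). -/
def evalX (σ : V → XTerm C R Ind) : QTerm V Ind → XTerm C R Ind :=
  QTerm.evalT XTerm.ind σ

/-- The relation ∼ on terms(q) for q, τ and dat(K): the smallest reflexive,
    symmetric and transitive relation closed under the fork rule. -/
inductive Sim (K : KB C R Ind) (q : CQ C R V Ind) (τ : V → DTerm C R Ind) :
    QTerm V Ind → QTerm V Ind → Prop where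
  | refl {t} : t ∈ q.terms → Sim K q τ t t
  | symm {s t} : Sim K q τ s t → Sim K q τ t s
  | trans {s t u} : Sim K q τ s t → Sim K q τ t u → Sim K q τ s u
  | fork {s s' t t' Rr P} : Sim K q τ s' t' → QAtom.role Rr s s' ∈ q.atoms →
      QAtom.role P t t' ∈ q.atoms → auxDat K (evalD τ s') → Sim K q τ s t

/-- The ∼-class of `t` is a vertex of G_aux, i.e. it contains a term mapped by
    τ to a 'true' auxiliary individual. -/
def isAuxVertex (K : KB C R Ind) (q : CQ C R V Ind) (τ : V → DTerm C R Ind)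
    (t : QTerm V Ind) : Prop :=
  ∃ t' ∈ q.terms, Sim K q τ t t' ∧ auxDat K (evalD τ t')

/-- The edge relation of G_aux, expressed on representatives modulo ∼:
    an edge from the class of u to the class of v for each atom R(s,t) of q
    with u ∼ s, v ∼ t and both classes vertices of G_aux. -/
def auxEdge (K : KB C R Ind) (q : CQ C R V Ind) (τ : V → DTerm C R Ind)
    (u v : QTerm V Ind) : Prop :=
  ∃ (S : R) (s t : QTerm V Ind), QAtom.role S s t ∈ q.atoms ∧
    Sim K q τ u s ∧ Sim K q τ v t ∧ isAuxVertex K q τ s ∧ isAuxVertex K q τ t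

/-- q is aux-cyclic w.r.t. τ and dat(K): G_aux contains a cycle. -/
def auxCyclic (K : KB C R Ind) (q : CQ C R V Ind) (τ : V → DTerm C R Ind) : Prop :=
  ∃ t, Relation.TransGen (auxEdge K q τ) t t

/-- isSpurious(q, dat(K), τ) = true. -/
def Spurious (K : KB C R Ind) (q : CQ C R V Ind) (τ : V → DTerm C R Ind) : Prop :=
  (∃ v, q.answers v ∧ ∀ a : Ind, τ v ≠ .ind a) ∨
  (∃ s t, Sim K q τ s t ∧ ¬ DM K (.eq (evalD τ s) (evalD τ t))) ∨
  auxCyclic K q τ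

open Classical in
/-- depth(w, I): 0 for terms outside aux(I), and 1 + depth of the argument for
    functional terms in aux(I). -/
noncomputable def depth (K : KB C R Ind) : XTerm C R Ind → ℕ
  | .ind _ => 0
  | .fn S A w => if auxT (XI K) XTerm.ind (.fn S A w) then 1 + depth K w else 0


/-- The terms that take part in the minimal model of Ξ(K): individuals that occur in it, and
functional terms introduced by some existential inclusion whose premise holds for the argument. -/
def Good (K : KB C R Ind) : XTerm C R Ind → Prop
  | .ind a => XI K (.eq (.ind a) (.ind a))
  | .fn S A w => ∃ A1, Ax.subEx A1 S A ∈ K.tbox ∧ XI K (.unary (ctU A1) w)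

def GoodFact (K : KB C R Ind) : Fact C R (XTerm C R Ind) → Prop
  | .unary _ w => Good K w
  | .role _ w w' => Good K w ∧ Good K w'
  | .eq w w' => Good K w ↔ Good K w'

theorem XI.goodFact {K : KB C R Ind} {f : Fact C R (XTerm C R Ind)} (h : XI K f) :
    GoodFact K f := by
  induction h with
  | abU h => exact .refl (.abU h) rfl
  | abR h => exact ⟨.refl (.abR h) (.inl rfl), .refl (.abR h) (.inr rfl)⟩
  | nom h => exact .refl (.nom h) rfl
  | sub _ _ ih => exact ih
  | subNom h h1 ih => exact iff_of_true ih (.refl (.subNom h h1) (.inr rfl))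
  | conj _ _ _ ih => exact ih
  | exSub _ _ _ ih => exact ih.1
  | subEx1 h h1 ih => exact ⟨ih, _, h, h1⟩
  | subEx2 h h1 => exact ⟨_, h, h1⟩
  | roleSub _ _ ih => exact ih
  | range _ _ ih => exact ih.2
  | topU _ _ ih => exact ih
  | topR1 _ _ ih => exact ih.1
  | topR2 _ _ ih => exact ih.2
  | refl => exact Iff.rfl
  | symm _ ih => exact Iff.symm ih
  | trans _ _ ih1 ih2 => exact Iff.trans ih1 ih2
  | repU _ _ ih1 ih2 => exact Iff.mp ih2 ih1
  | repR1 _ _ ih1 ih2 => exact ⟨Iff.mp ih2 ih1.1, ih1.2⟩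
  | repR2 _ _ ih1 ih2 => exact ⟨ih1.1, Iff.mp ih2 ih1.2⟩
  | repF h =>
    exact ⟨fun ⟨A1, h1, h2⟩ => ⟨A1, h1, h2.repU h⟩, fun ⟨A1, h1, h2⟩ => ⟨A1, h1, h2.repU h.symm⟩⟩

theorem Good.eq_self {K : KB C R Ind} {w : XTerm C R Ind} (h : Good K w) : XI K (.eq w w) := by
  cases w with
  | ind a => exact h
  | fn S A w =>
    obtain ⟨A1, h1, h2⟩ := h
    exact .refl (.subEx2 h1 h2) rfl

theorem Good.of_eq {K : KB C R Ind} {w w' : XTerm C R Ind} (h : Good K w)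
    (e : XI K (.eq w w')) : Good K w' :=
  Iff.mp e.goodFact h

def DeltaFact (K : KB C R Ind) : Fact C R (XTerm C R Ind) → Prop
  | .unary B w => DM K (.unary B (δ w))
  | .role S w w' => DM K (.role S (δ w) (δ w'))
  | .eq w w' => δ w = δ w' ∨ DM K (.eq (δ w) (δ w'))

/-- δ maps the minimal model of Ξ(K) homomorphically to that of dat(K), where terms equal in Ξ(K)
may also be identified by δ. -/
theorem XI.deltaFact {K : KB C R Ind} {f : Fact C R (XTerm C R Ind)} (h : XI K f) :
    DeltaFact K f := by
  induction h with
  | abU h => exact .abU h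
  | abR h => exact .abR h
  | nom h => exact .nom h
  | sub h _ ih => exact .sub h ih
  | subNom h _ ih => exact .inr (.subNom h ih)
  | conj h _ _ ih1 ih2 => exact .conj h ih1 ih2
  | exSub h _ _ ih1 ih2 => exact .exSub h ih1 ih2
  | subEx1 h _ ih => exact .subEx1 h ih
  | subEx2 h _ ih => exact .subEx2 h ih
  | roleSub h _ ih => exact .roleSub h ih
  | range h _ ih => exact .range h ih
  | topU h _ ih => exact .topU h ih
  | topR1 h _ ih => exact .topR1 h ih
  | topR2 h _ ih => exact .topR2 h ih
  | refl => exact .inl rfl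
  | symm _ ih => exact ih.imp Eq.symm .symm
  | trans _ _ ih1 ih2 =>
    simp only [DeltaFact] at *
    rcases ih1 with e1 | e1
    · rwa [e1]
    · rcases ih2 with e2 | e2
      · exact .inr (e2 ▸ e1)
      · exact .inr (e1.trans e2)
  | repU _ _ ih1 ih2 =>
    simp only [DeltaFact] at *
    rcases ih2 with e | e
    · exact e ▸ ih1
    · exact ih1.repU e
  | repR1 _ _ ih1 ih2 =>
    simp only [DeltaFact] at *
    rcases ih2 with e | e
    · exact e ▸ ih1
    · exact ih1.repR1 e
  | repR2 _ _ ih1 ih2 =>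
    simp only [DeltaFact] at *
    rcases ih2 with e | e
    · exact e ▸ ih1
    · exact ih1.repR2 e
  | repF => exact .inl rfl

def Liftable (K : KB C R Ind) (u : DTerm C R Ind) : Prop := ∃ w, Good K w ∧ δ w = u

/-- `u` equals the individual `c` in dat(K), and so do all its preimages in Ξ(K). -/
def NamedBy (K : KB C R Ind) (u : DTerm C R Ind) (c : Ind) : Prop :=
  DM K (.eq u (.ind c)) ∧ ∀ w, Good K w → δ w = u → XI K (.eq w (.ind c))

def Reflected (K : KB C R Ind) : Fact C R (DTerm C R Ind) → Prop
  | .unary B u => Liftable K u ∧ ∀ w, Good K w → δ w = u → XI K (.unary B w)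
  | .role S u v => Liftable K u ∧ Liftable K v ∧
      ((∃ c, NamedBy K v c ∧ ∀ w, Good K w → δ w = u → XI K (.role S w (.ind c))) ∨
        ∃ S0 A0, v = .aux S0 A0 ∧ (∀ w, Good K w → δ w = u → Good K (.fn S0 A0 w)) ∧
          ∀ w, Good K (.fn S0 A0 w) → XI K (.role S w (.fn S0 A0 w)))
  | .eq u v => Liftable K u ∧ Liftable K v ∧ (u = v ∨ ∃ c, NamedBy K u c ∧ NamedBy K v c)

theorem NamedBy.of_ind {K : KB C R Ind} {a : Ind} (h : DM K (.eq (.ind a) (.ind a))) :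
    NamedBy K (.ind a) a := by
  refine ⟨h, fun w hw e => ?_⟩
  cases w with
  | ind b => cases e; exact hw
  | fn => cases e

theorem NamedBy.eq_ind {K : KB C R Ind} {u : DTerm C R Ind} {c d : Ind} (hu : Liftable K u)
    (hc : NamedBy K u c) (hd : NamedBy K u d) : XI K (.eq (.ind c) (.ind d)) := by
  obtain ⟨w, hw, e⟩ := hu
  exact (hc.2 w hw e).symm.trans (hd.2 w hw e)

theorem NamedBy.change {K : KB C R Ind} {u v : DTerm C R Ind} {c d : Ind} (hu : Liftable K u)
    (hc : NamedBy K u c) (hd : NamedBy K u d) (hv : NamedBy K v d) : NamedBy K v c :=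
  ⟨hv.1.trans (hd.1.symm.trans hc.1),
    fun w hw e => (hv.2 w hw e).trans (NamedBy.eq_ind hu hd hc)⟩

theorem forall_good_ind {K : KB C R Ind} {P : XTerm C R Ind → Prop} {a : Ind} (h : P (.ind a)) :
    ∀ w, Good K w → δ w = .ind a → P w := by
  intro w _ e
  cases w with
  | ind b => cases e; exact h
  | fn => cases e

/-- A unary consequence of the target of a role holds at all preimages of the target. -/
theorem Reflected.target {K : KB C R Ind} {S : R} {u v : DTerm C R Ind} {B : UPred C}
    (h : Reflected K (.role S u v))
    (hB : ∀ w w', XI K (.role S w w') → XI K (.unary B w')) : Reflected K (.unary B v) := by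
  obtain ⟨⟨w0, hw0, e0⟩, hv, ⟨c, hc, hr⟩ | ⟨S0, A0, rfl, -, hr⟩⟩ := h
  · exact ⟨hv, fun w hw e => (hB _ _ (hr w0 hw0 e0)).repU (hc.2 w hw e).symm⟩
  · refine ⟨hv, fun w hw e => ?_⟩
    cases w with
    | ind => cases e
    | fn S1 A1 w => cases e; exact hB _ _ (hr w hw)

/-- A unary consequence of a role and a property of its target, for the source of the role. -/
theorem Reflected.source {K : KB C R Ind} {S : R} {u v : DTerm C R Ind} {B : UPred C}
    (h : Reflected K (.role S u v))
    (hB : ∀ w w', XI K (.role S w w') →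
      (∃ w'', Good K w'' ∧ δ w'' = v ∧ XI K (.eq w'' w')) → XI K (.unary B w)) :
    Reflected K (.unary B u) := by
  obtain ⟨hu, ⟨w1, hw1, e1⟩, ⟨c, hc, hr⟩ | ⟨S0, A0, rfl, hg, hr⟩⟩ := h
  · exact ⟨hu, fun w hw e => hB w _ (hr w hw e)
      ⟨w1, hw1, e1, hc.2 w1 hw1 e1⟩⟩
  · exact ⟨hu, fun w hw e => hB w _ (hr w (hg w hw e))
      ⟨_, hg w hw e, rfl, (hg w hw e).eq_self⟩⟩

theorem DM.reflected {K : KB C R Ind} {f : Fact C R (DTerm C R Ind)} (h : DM K f) :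
    Reflected K f := by
  induction h with
  | abU h => exact ⟨⟨.ind _, (XI.abU h).goodFact, rfl⟩, forall_good_ind (.abU h)⟩
  | abR h =>
    exact ⟨⟨_, (XI.abR h).goodFact.1, rfl⟩, ⟨_, (XI.abR h).goodFact.2, rfl⟩,
      .inl ⟨_, .of_ind (.refl (.abR h) (.inr rfl)), forall_good_ind (.abR h)⟩⟩
  | nom h => exact ⟨⟨.ind _, (XI.nom h).goodFact, rfl⟩, forall_good_ind (.nom h)⟩
  | sub h _ ih => exact ⟨ih.1, fun w hw e => .sub h (ih.2 w hw e)⟩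
  | subNom h h1 ih =>
    obtain ⟨⟨w, hw, e⟩, ih⟩ := ih
    exact ⟨⟨w, hw, e⟩, ⟨_, hw.of_eq (.subNom h (ih w hw e)), rfl⟩,
      .inr ⟨_, ⟨.subNom h h1, fun w hw e => .subNom h (ih w hw e)⟩,
        .of_ind (.refl (.subNom h h1) (.inr rfl))⟩⟩
  | conj h _ _ ih1 ih2 => exact ⟨ih1.1, fun w hw e => .conj h (ih1.2 w hw e) (ih2.2 w hw e)⟩
  | exSub h _ _ ih1 ih2 =>
    exact ih1.source fun _ _ hr ⟨w'', hw, e, he⟩ => .exSub h hr ((ih2.2 w'' hw e).repU he)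
  | subEx1 h _ ih =>
    obtain ⟨⟨w, hw, e⟩, ih⟩ := ih
    exact ⟨⟨w, hw, e⟩, ⟨.fn _ _ w, ⟨_, h, ih w hw e⟩, rfl⟩, .inr ⟨_, _, rfl,
      fun w hw e => ⟨_, h, ih w hw e⟩, fun w ⟨_, h1, h2⟩ => .subEx1 h1 h2⟩⟩
  | subEx2 h _ ih =>
    obtain ⟨⟨w, hw, e⟩, ih⟩ := ih
    refine ⟨⟨.fn _ _ w, ⟨_, h, ih w hw e⟩, rfl⟩, fun w hw e => ?_⟩
    cases w with
    | ind => cases e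
    | fn S1 A1 w =>
      cases e
      obtain ⟨_, h1, h2⟩ := hw
      exact .subEx2 h1 h2
  | roleSub h _ ih =>
    obtain ⟨hu, hv, ⟨c, hc, hr⟩ | ⟨S0, A0, e, hg, hr⟩⟩ := ih
    · exact ⟨hu, hv, .inl ⟨c, hc, fun w hw e => .roleSub h (hr w hw e)⟩⟩
    · exact ⟨hu, hv, .inr ⟨S0, A0, e, hg, fun w hw => .roleSub h (hr w hw)⟩⟩
  | range h _ ih => exact ih.target fun _ _ => .range h
  | topU h _ ih => exact ⟨ih.1, fun w hw e => .topU h (ih.2 w hw e)⟩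
  | topR1 h _ ih => exact ih.source fun _ _ hr _ => .topR1 h hr
  | topR2 h _ ih => exact ih.target fun _ _ => .topR2 h
  | @refl w f _ ho ih =>
    have : Liftable K w := by
      cases f with
      | unary => cases ho; exact ih.1
      | role => rcases ho with rfl | rfl; exacts [ih.1, ih.2.1]
      | eq => rcases ho with rfl | rfl; exacts [ih.1, ih.2.1]
    exact ⟨this, this, .inl rfl⟩
  | symm _ ih => exact ⟨ih.2.1, ih.1, ih.2.2.imp Eq.symm fun ⟨c, h1, h2⟩ => ⟨c, h2, h1⟩⟩
  | trans _ _ ih1 ih2 =>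
    obtain ⟨hu, hv, rfl | ⟨c, h1, h2⟩⟩ := ih1
    · exact ih2
    · obtain ⟨-, hw, rfl | ⟨d, h3, h4⟩⟩ := ih2
      · exact ⟨hu, hv, .inr ⟨c, h1, h2⟩⟩
      · exact ⟨hu, hw, .inr ⟨c, h1, .change hv h2 h3 h4⟩⟩
  | repU _ _ ih1 ih2 =>
    obtain ⟨⟨w0, hw0, e0⟩, hv, rfl | ⟨c, h1, h2⟩⟩ := ih2
    · exact ih1
    · exact ⟨hv, fun w hw e =>
        (ih1.2 w0 hw0 e0).repU ((h1.2 w0 hw0 e0).trans (h2.2 w hw e).symm)⟩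
  | repR1 _ _ ih1 ih2 =>
    obtain ⟨⟨w0, hw0, e0⟩, hv, rfl | ⟨c, h1, h2⟩⟩ := ih2
    · exact ih1
    · have key : ∀ w, Good K w → δ w = _ → XI K (.eq w0 w) := fun w hw e =>
        (h1.2 w0 hw0 e0).trans (h2.2 w hw e).symm
      obtain ⟨-, hv', ⟨d, hd, hr⟩ | ⟨S0, A0, e', hg, hr⟩⟩ := ih1
      · exact ⟨hv, hv', .inl ⟨d, hd, fun w hw e => (hr w0 hw0 e0).repR1 (key w hw e)⟩⟩
      · exact ⟨hv, hv', .inr ⟨S0, A0, e', fun w hw e =>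
          (hg w0 hw0 e0).of_eq (.repF (key w hw e)), hr⟩⟩
  | repR2 _ _ ih1 ih2 =>
    obtain ⟨hu, hv, rfl | ⟨c, h1, h2⟩⟩ := ih2
    · exact ih1
    · obtain ⟨hw, hv', ⟨d, hd, hr⟩ | ⟨S0, A0, rfl, hg, hr⟩⟩ := ih1
      · exact ⟨hw, hv, .inl ⟨c, h2, fun w hw e => (hr w hw e).repR2 (NamedBy.eq_ind hu hd h1)⟩⟩
      · exact ⟨hw, hv, .inl ⟨c, h2, fun w hw e =>
          (hr w (hg w hw e)).repR2 (h1.2 _ (hg w hw e) rfl)⟩⟩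

theorem DM.xi_eq {K : KB C R Ind} {w w' : XTerm C R Ind} (h : DM K (.eq (δ w) (δ w')))
    (hw : Good K w) (hw' : Good K w') (hn : ¬ auxDat K (δ w)) : XI K (.eq w w') := by
  obtain ⟨a, ha⟩ : ∃ a, DM K (.eq (δ w) (.ind a)) := by simpa [auxDat] using hn
  have key : ∀ v, DM K (.eq v (.ind a)) → NamedBy K v a := by
    intro v hv
    obtain ⟨h1, h2, rfl | ⟨c, hc, hc'⟩⟩ := hv.reflected
    · exact .of_ind hv
    · exact .change h2 (.of_ind (hv.symm.trans hv)) hc' hc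
  exact ((key _ ha).2 w hw rfl).trans ((key _ (h.symm.trans ha)).2 w' hw' rfl).symm

theorem DM.eq_of_auxDat {K : KB C R Ind} {u v : DTerm C R Ind} (h : DM K (.eq u v))
    (hu : auxDat K u) : u = v := by
  obtain ⟨-, -, e | ⟨c, hc, -⟩⟩ := h.reflected
  · exact e
  · exact absurd hc.1 (hu c)

/-- Non-named terms of Ξ(K) are arranged as a forest, up to equality. -/
def ForestFact (K : KB C R Ind) : Fact C R (XTerm C R Ind) → Prop
  | .unary _ _ => True
  | .role _ w w' => (∃ c : Ind, XI K (.eq w' (.ind c))) ∨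
      ∃ S A w0, w' = .fn S A w0 ∧ XI K (.eq w w0)
  | .eq w w' => (∃ c : Ind, XI K (.eq w (.ind c)) ∧ XI K (.eq w' (.ind c))) ∨ w = w' ∨
      ∃ S A w0 w0', w = .fn S A w0 ∧ w' = .fn S A w0' ∧ XI K (.eq w0 w0')

theorem XI.forestFact {K : KB C R Ind} {f : Fact C R (XTerm C R Ind)} (h : XI K f) :
    ForestFact K f := by
  induction h with
  | abU | nom | sub | conj | exSub | subEx2 | range | topU | topR1 | topR2 | repU => trivial
  | abR h => exact .inl ⟨_, .refl (.abR h) (.inr rfl)⟩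
  | subNom h h1 => exact .inl ⟨_, .subNom h h1, .refl (.subNom h h1) (.inr rfl)⟩
  | subEx1 _ h1 => exact .inr ⟨_, _, _, rfl, .refl h1 rfl⟩
  | roleSub _ _ ih => exact ih
  | refl => exact .inr (.inl rfl)
  | symm _ ih =>
    obtain ⟨c, h1, h2⟩ | rfl | ⟨S, A, w, w', rfl, rfl, h⟩ := ih
    · exact .inl ⟨c, h2, h1⟩
    · exact .inr (.inl rfl)
    · exact .inr (.inr ⟨S, A, w', w, rfl, rfl, h.symm⟩)
  | trans h1 h2 ih1 ih2 =>
    obtain ⟨c, h3, h4⟩ | rfl | ⟨S, A, w, w', rfl, rfl, h⟩ := ih1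
    · exact .inl ⟨c, h3, h2.symm.trans h4⟩
    · exact ih2
    · obtain ⟨c, h3, h4⟩ | rfl | ⟨S, A, w, w', e, rfl, h'⟩ := ih2
      · exact .inl ⟨c, h1.trans h3, h4⟩
      · exact .inr (.inr ⟨S, A, _, _, rfl, rfl, h⟩)
      · cases e
        exact .inr (.inr ⟨S, A, _, _, rfl, rfl, h.trans h'⟩)
  | repR1 _ h ih =>
    obtain hc | ⟨S, A, w, rfl, h'⟩ := ih
    · exact .inl hc
    · exact .inr ⟨S, A, w, rfl, h.symm.trans h'⟩
  | repR2 _ h ih1 ih2 =>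
    obtain ⟨c, hc⟩ | ⟨S, A, w, rfl, h'⟩ := ih1
    · exact .inl ⟨c, h.symm.trans hc⟩
    · obtain ⟨c, -, h4⟩ | rfl | ⟨S, A, w, w', e, rfl, h1⟩ := ih2
      · exact .inl ⟨c, h4⟩
      · exact .inr ⟨S, A, w, rfl, h'⟩
      · cases e
        exact .inr ⟨S, A, w', rfl, h'.trans h1⟩
  | repF h => exact .inr (.inr ⟨_, _, _, _, rfl, rfl, h⟩)

open Classical in
/-- The number of function symbols above the nearest named subterm. -/
noncomputable def namedDepth (K : KB C R Ind) : XTerm C R Ind → ℕ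
  | .ind _ => 0
  | .fn S A w => if ∃ c : Ind, XI K (.eq (.fn S A w) (.ind c)) then 0 else 1 + namedDepth K w

theorem namedDepth_of_named {K : KB C R Ind} {w : XTerm C R Ind} {c : Ind}
    (h : XI K (.eq w (.ind c))) : namedDepth K w = 0 := by
  cases w with
  | ind => rfl
  | fn S A w => exact if_pos ⟨c, h⟩

theorem XI.namedDepth_eq {K : KB C R Ind} {w w' : XTerm C R Ind} (h : XI K (.eq w w')) :
    namedDepth K w = namedDepth K w' := by
  induction w generalizing w' with
  | ind a => rw [namedDepth_of_named h.symm]; rfl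
  | fn S A w ih =>
    obtain ⟨c, h1, h2⟩ | rfl | ⟨S, A, w0, w', e, rfl, h'⟩ := h.forestFact
    · rw [namedDepth_of_named h1, namedDepth_of_named h2]
    · rfl
    · cases e
      by_cases hc : ∃ c : Ind, XI K (.eq (.fn S A w) (.ind c))
      · obtain ⟨c, hc⟩ := hc
        rw [namedDepth_of_named hc, namedDepth_of_named (h.symm.trans hc)]
      · have hc' : ¬ ∃ c : Ind, XI K (.eq (.fn S A w') (.ind c)) :=
          fun ⟨c, h1⟩ => hc ⟨c, h.trans h1⟩
        rw [namedDepth, namedDepth, if_neg hc, if_neg hc', ih h']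

section Query

variable {K : KB C R Ind} {q : CQ C R V Ind}

theorem CQ.mem_terms_unary {B : UPred C} {t : QTerm V Ind} (h : QAtom.unary B t ∈ q.atoms) :
    t ∈ q.terms :=
  List.mem_flatMap.2 ⟨_, h, by simp⟩

theorem CQ.mem_terms_source {S : R} {s t : QTerm V Ind} (h : QAtom.role S s t ∈ q.atoms) :
    s ∈ q.terms :=
  List.mem_flatMap.2 ⟨_, h, by simp⟩

theorem CQ.mem_terms_target {S : R} {s t : QTerm V Ind} (h : QAtom.role S s t ∈ q.atoms) :
    t ∈ q.terms :=
  List.mem_flatMap.2 ⟨_, h, by simp⟩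

theorem CQ.exists_atom {t : QTerm V Ind} (h : t ∈ q.terms) :
    (∃ B, QAtom.unary B t ∈ q.atoms) ∨ ∃ S s s', QAtom.role S s s' ∈ q.atoms ∧
      (s = t ∨ s' = t) := by
  obtain ⟨a, ha, h⟩ := List.mem_flatMap.1 h
  cases a with
  | unary B s => simp at h; subst h; exact .inl ⟨B, ha⟩
  | role S s s' =>
    simp at h
    exact .inr ⟨S, s, s', ha, h.imp Eq.symm Eq.symm⟩

theorem holdsX.eq_self {σ : V → XTerm C R Ind} (h : holdsX K q σ) {t : QTerm V Ind}
    (ht : t ∈ q.terms) : XI K (.eq (evalX σ t) (evalX σ t)) := by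
  obtain ⟨B, hB⟩ | ⟨S, s, s', hS, rfl | rfl⟩ := CQ.exists_atom ht
  · exact .refl (h _ hB) rfl
  · exact .refl (h _ hS) (.inl rfl)
  · exact .refl (h _ hS) (.inr rfl)

theorem holdsD.eq_self {τ : V → DTerm C R Ind} (h : holdsD K q τ) {t : QTerm V Ind}
    (ht : t ∈ q.terms) : DM K (.eq (evalD τ t) (evalD τ t)) := by
  obtain ⟨B, hB⟩ | ⟨S, s, s', hS, rfl | rfl⟩ := CQ.exists_atom ht
  · exact .refl (h _ hB) rfl
  · exact .refl (h _ hS) (.inl rfl)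
  · exact .refl (h _ hS) (.inr rfl)

theorem Sim.mem_terms {τ : V → DTerm C R Ind} {s t : QTerm V Ind} (h : Sim K q τ s t) :
    s ∈ q.terms ∧ t ∈ q.terms := by
  induction h with
  | refl h => exact ⟨h, h⟩
  | symm _ ih => exact ih.symm
  | trans _ _ ih1 ih2 => exact ⟨ih1.1, ih2.2⟩
  | fork _ h1 h2 => exact ⟨CQ.mem_terms_source h1, CQ.mem_terms_source h2⟩

/-! ### Answers over Ξ(K) induce non-spurious answers over dat(K) -/

theorem δ_evalX (σ : V → XTerm C R Ind) (t : QTerm V Ind) :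
    δ (evalX σ t) = evalD (fun v => δ (σ v)) t := by
  cases t <;> rfl

theorem holdsX.holdsD {σ : V → XTerm C R Ind} (h : holdsX K q σ) :
    holdsD K q (fun v => δ (σ v)) := by
  intro a ha
  have := (h a ha).deltaFact
  cases a with
  | unary B t =>
    have : DM K (.unary B (δ (evalX σ t))) := this
    rwa [δ_evalX] at this
  | role S s t =>
    have : DM K (.role S (δ (evalX σ s)) (δ (evalX σ t))) := this
    rwa [δ_evalX, δ_evalX] at this

theorem holdsX.not_named {σ : V → XTerm C R Ind} (h : holdsX K q σ) {t : QTerm V Ind}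
    (ht : t ∈ q.terms) (ha : auxDat K (evalD (fun v => δ (σ v)) t)) (c : Ind) :
    ¬ XI K (.eq (evalX σ t) (.ind c)) := by
  intro hc
  have hr := h.holdsD.eq_self ht
  rw [← δ_evalX] at ha hr
  rcases hc.deltaFact with e | e
  · have e' : δ (evalX σ t) = .ind c := e
    apply ha c
    rwa [e'] at hr ⊢
  · exact ha c e

theorem Sim.xi_eq {σ : V → XTerm C R Ind} (h : holdsX K q σ) {s t : QTerm V Ind}
    (hst : Sim K q (fun v => δ (σ v)) s t) : XI K (.eq (evalX σ s) (evalX σ t)) := by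
  induction hst with
  | refl ht => exact h.eq_self ht
  | symm _ ih => exact ih.symm
  | trans _ _ ih1 ih2 => exact ih1.trans ih2
  | @fork s s' t t' Rr P _ h1 h2 ha ih =>
    have hn := h.not_named (CQ.mem_terms_target h1) ha
    have f1 : ForestFact K (.role Rr (evalX σ s) (evalX σ s')) := (h _ h1).forestFact
    have f2 : ForestFact K (.role P (evalX σ t) (evalX σ t')) := (h _ h2).forestFact
    obtain ⟨c, hc⟩ | ⟨S, A, w, e1, hw⟩ := f1
    · exact absurd hc (hn c)
    obtain ⟨c, hc⟩ | ⟨S', A', w', e2, hw'⟩ := f2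
    · exact absurd (ih.trans hc) (hn c)
    obtain ⟨c, hc, -⟩ | e | ⟨S0, A0, w0, w0', e3, e4, h0⟩ := ih.forestFact
    · exact absurd hc (hn c)
    · rw [e1, e2] at e
      cases e
      exact hw.trans hw'.symm
    · rw [e1] at e3
      rw [e2] at e4
      cases e3
      cases e4
      exact hw.trans (h0.trans hw'.symm)

theorem isAuxVertex.not_named {σ : V → XTerm C R Ind} (h : holdsX K q σ) {t : QTerm V Ind}
    (ht : isAuxVertex K q (fun v => δ (σ v)) t) (c : Ind) :
    ¬ XI K (.eq (evalX σ t) (.ind c)) := by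
  obtain ⟨t', ht', hs, ha⟩ := ht
  exact fun hc => h.not_named ht' ha c ((hs.xi_eq h).symm.trans hc)

theorem auxEdge.namedDepth_lt {σ : V → XTerm C R Ind} (h : holdsX K q σ) {u v : QTerm V Ind}
    (he : auxEdge K q (fun v => δ (σ v)) u v) :
    namedDepth K (evalX σ u) < namedDepth K (evalX σ v) := by
  obtain ⟨S, s, t, hS, hu, hv, -, ht⟩ := he
  rw [(hu.xi_eq h).namedDepth_eq, (hv.xi_eq h).namedDepth_eq]
  have hn := ht.not_named h
  have f : ForestFact K (.role S (evalX σ s) (evalX σ t)) := (h _ hS).forestFact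
  obtain ⟨c, hc⟩ | ⟨S, A, w, e, hw⟩ := f
  · exact absurd hc (hn c)
  · rw [e] at hn ⊢
    rw [namedDepth, if_neg (fun ⟨c, hc⟩ => hn c hc), hw.namedDepth_eq]
    omega

theorem holdsX.not_spurious {σ : V → XTerm C R Ind} (h : holdsX K q σ) {π : V → Ind}
    (hπ : ∀ v, q.answers v → σ v = .ind (π v)) : ¬ Spurious K q (fun v => δ (σ v)) := by
  rintro (⟨v, hv, hn⟩ | ⟨s, t, hs, hn⟩ | ⟨t, ht⟩)
  · exact hn (π v) (congrArg δ (hπ v hv))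
  · rcases (hs.xi_eq h).deltaFact with e | e
    · rw [δ_evalX, δ_evalX] at e
      apply hn
      rw [← e]
      exact h.holdsD.eq_self hs.mem_terms.1
    · rw [δ_evalX, δ_evalX] at e
      exact hn e
  · have key : ∀ {u v}, Relation.TransGen (auxEdge K q (fun v => δ (σ v))) u v →
        namedDepth K (evalX σ u) < namedDepth K (evalX σ v) := by
      intro u v huv
      induction huv with
      | single h1 => exact h1.namedDepth_lt h
      | tail _ h1 ih => exact ih.trans (h1.namedDepth_lt h)
    exact lt_irrefl _ (key ht)

/-! ### Non-spurious answers over dat(K) unfold to answers over Ξ(K) -/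

/-- `Realises K q τ L t w`: unfolding the query term `t` along the role atoms of `q` that lead to
it may yield the term `w`, where `L` picks preimages for the terms without predecessors. -/
inductive Realises (K : KB C R Ind) (q : CQ C R V Ind) (τ : V → DTerm C R Ind)
    (L : DTerm C R Ind → XTerm C R Ind) : QTerm V Ind → XTerm C R Ind → Prop where
  | named {t c} : DM K (.eq (evalD τ t) (.ind c)) → Realises K q τ L t (.ind c)
  | pred {t t' s P S A w} : auxDat K (evalD τ t) → evalD τ t = .aux S A → Sim K q τ t t' →
      QAtom.role P s t' ∈ q.atoms → Realises K q τ L s w → Realises K q τ L t (.fn S A w)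
  | root {t} : auxDat K (evalD τ t) → t ∈ q.terms →
      (∀ t' P s, Sim K q τ t t' → QAtom.role P s t' ∉ q.atoms) →
      Realises K q τ L t (L (evalD τ t))

variable {τ : V → DTerm C R Ind} {L : DTerm C R Ind → XTerm C R Ind}

theorem Realises.good (h : holdsD K q τ)
    (hsim : ∀ s t, Sim K q τ s t → DM K (.eq (evalD τ s) (evalD τ t)))
    (hL : ∀ u, Liftable K u → Good K (L u) ∧ δ (L u) = u) {t : QTerm V Ind} {w : XTerm C R Ind}
    (hw : Realises K q τ L t w) : Good K w ∧ DM K (.eq (evalD τ t) (δ w)) := by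
  induction hw with
  | @named t c hc =>
    refine ⟨?_, hc⟩
    obtain ⟨w, hw, e⟩ := hc.reflected.2.1
    cases w with
    | ind => cases e; exact hw
    | fn => cases e
  | @pred t t' s P S A w ha e hs hP _ ih =>
    have e' : evalD τ t' = .aux S A := (DM.eq_of_auxDat (hsim _ _ hs) ha).symm.trans e
    have hr : DM K (.role P (evalD τ s) (evalD τ t')) := h _ hP
    have hr := hr.repR1 ih.2
    rw [e'] at hr
    rw [e] at ha
    refine ⟨?_, by simpa only [e, δ] using h.eq_self hs.mem_terms.1⟩
    obtain ⟨-, -, ⟨c, hc, -⟩ | ⟨S0, A0, e0, hg, -⟩⟩ := hr.reflected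
    · exact absurd hc.1 (ha c)
    · cases e0
      exact hg w ih.1 rfl
  | @root t ha ht _ =>
    have hl := h.eq_self ht
    obtain ⟨h1, h2⟩ := hL _ hl.reflected.1
    exact ⟨h1, by rwa [h2]⟩

theorem auxDat.of_eq {u v : DTerm C R Ind} (hu : auxDat K u) (e : DM K (.eq u v)) :
    auxDat K v :=
  fun c hc => hu c (e.trans hc)

theorem Realises.eq_of_sim (h : holdsD K q τ)
    (hsim : ∀ s t, Sim K q τ s t → DM K (.eq (evalD τ s) (evalD τ t)))
    (hL : ∀ u, Liftable K u → Good K (L u) ∧ δ (L u) = u) {t t' : QTerm V Ind}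
    {w w' : XTerm C R Ind} (hw : Realises K q τ L t w) (hw' : Realises K q τ L t' w')
    (hs : Sim K q τ t t') : XI K (.eq w w') := by
  have hg := hw.good h hsim hL
  induction hw generalizing t' w' with
  | @named t c hc =>
    have hg' := hw'.good h hsim hL
    exact DM.xi_eq (hc.symm.trans ((hsim _ _ hs).trans hg'.2)) hg.1 hg'.1
      fun ha => ha c (hc.symm.trans hc)
  | @pred t t1 s P S A w ha e h1 hP hr ih =>
    cases hw' with
    | named hc => exact absurd hc (ha.of_eq (hsim _ _ hs) _)
    | @pred _ t2 s' P' S' A' w' ha' e' h1' hP' hr' =>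
      have e2 := DM.eq_of_auxDat (hsim _ _ hs) ha
      rw [e, e'] at e2
      cases e2
      exact .repF (ih hr' (.fork (h1.symm.trans (hs.trans h1')) hP hP'
        (ha.of_eq (hsim _ _ h1))) (hr.good h hsim hL))
    | root _ _ hn => exact absurd hP (hn _ _ _ (hs.symm.trans h1))
  | @root t ha ht hn =>
    cases hw' with
    | named hc => exact absurd hc (ha.of_eq (hsim _ _ hs) _)
    | pred _ _ h1 hP => exact absurd hP (hn _ _ _ (hs.trans h1))
    | root =>
      rw [← DM.eq_of_auxDat (hsim _ _ hs) ha]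
      exact hg.1.eq_self

theorem Realises.exists (hD : holdsD K q τ) (hc : ¬ auxCyclic K q τ) {t : QTerm V Ind}
    (ht : t ∈ q.terms) :
    ∃ w, Realises K q τ L t w := by
  let r : {t // t ∈ q.terms} → {t // t ∈ q.terms} → Prop :=
    fun a b => Relation.TransGen (auxEdge K q τ) a b
  have : Finite {t // t ∈ q.terms} := q.terms.finite_toSet
  have : IsTrans _ r := ⟨fun _ _ _ => Relation.TransGen.trans⟩
  have : Std.Irrefl r := ⟨fun a ha => hc ⟨a, ha⟩⟩
  have hwf : WellFounded r := Finite.wellFounded_of_trans_of_irrefl r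
  suffices ∀ t : {t // t ∈ q.terms}, ∃ w, Realises K q τ L t w from this ⟨t, ht⟩
  intro t
  induction t using hwf.induction with
  | _ t ih =>
    by_cases ha : auxDat K (evalD τ t)
    · by_cases hp : ∃ t' P s, Sim K q τ t t' ∧ QAtom.role P s t' ∈ q.atoms
      · obtain ⟨t', P, s, hs, hP⟩ := hp
        have hmem := CQ.mem_terms_source hP
        obtain ⟨w, hw⟩ : ∃ w, Realises K q τ L s w := by
          by_cases has : auxDat K (evalD τ s)
          · exact ih ⟨s, hmem⟩ (.single ⟨P, s, t', hP, .refl hmem, hs,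
              ⟨s, hmem, .refl hmem, has⟩, ⟨t, t.2, hs.symm, ha⟩⟩)
          · obtain ⟨c, hc⟩ : ∃ c, DM K (.eq (evalD τ s) (.ind c)) := by simpa [auxDat] using has
            exact ⟨_, .named hc⟩
        cases e : evalD τ t with
        | ind a => exact absurd (by simpa only [e] using hD.eq_self t.2) (ha a)
        | aux S A => exact ⟨_, .pred ha e hs hP hw⟩
      · exact ⟨_, .root ha t.2 fun t' P s hs hP => hp ⟨t', P, s, hs, hP⟩⟩
    · obtain ⟨c, hc⟩ : ∃ c, DM K (.eq (evalD τ t) (.ind c)) := by simpa [auxDat] using ha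
      exact ⟨_, .named hc⟩

theorem Realises.holdsX (h : holdsD K q τ)
    (hsim : ∀ s t, Sim K q τ s t → DM K (.eq (evalD τ s) (evalD τ t)))
    (hL : ∀ u, Liftable K u → Good K (L u) ∧ δ (L u) = u) {σ : V → XTerm C R Ind}
    (hσ : ∀ t ∈ q.terms, Realises K q τ L t (evalX σ t)) : holdsX K q σ := by
  intro a ha
  cases a with
  | unary B t =>
    obtain ⟨hg, e⟩ := (hσ t (CQ.mem_terms_unary ha)).good h hsim hL
    have hB : DM K (.unary B (evalD τ t)) := h _ ha
    exact (hB.repU e).reflected.2 _ hg rfl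
  | role S s t =>
    have hs := hσ s (CQ.mem_terms_source ha)
    have ht := hσ t (CQ.mem_terms_target ha)
    obtain ⟨hgs, es⟩ := hs.good h hsim hL
    obtain ⟨hgt, et⟩ := ht.good h hsim hL
    have hS : DM K (.role S (evalD τ s) (evalD τ t)) := h _ ha
    change XI K (.role S (evalX σ s) (evalX σ t))
    obtain ⟨-, -, ⟨c, hc, hr⟩ | ⟨S0, A0, e0, hg, hr⟩⟩ := ((hS.repR1 es).repR2 et).reflected
    · exact (hr _ hgs rfl).repR2 (hc.2 _ hgt rfl).symm
    · generalize evalX σ t = w' at *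
      have hrefl := Sim.refl (K := K) (τ := τ) (CQ.mem_terms_target ha)
      cases ht with
      | named => cases e0
      | pred haux _ h1 hP hw =>
        cases e0
        have hss := Sim.fork h1 ha hP haux
        exact (hr _ (hg _ hgs rfl)).repR2 (.repF (hs.eq_of_sim h hsim hL hw hss))
      | root _ _ hn => exact absurd ha (hn _ _ _ hrefl)

end Query

/-- Correctness of the combined approach: for a satisfiable K, a candidate
    answer π is a certain answer to q over Ξ(K) iff it is witnessed by some
    non-spurious answer τ of q over dat(K). -/
theorem combined_approach_correct (K : KB C R Ind)
    (hsat : ¬ ∃ w : XTerm C R Ind, XI K (.unary .bot w))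
    (q : CQ C R V Ind) (π : V → Ind) :
    (∃ σ : V → XTerm C R Ind,
        (∀ v, q.answers v → σ v = .ind (π v)) ∧ holdsX K q σ)
  ↔ (∃ τ : V → DTerm C R Ind,
        (∀ v, q.answers v → τ v = .ind (π v)) ∧ holdsD K q τ ∧
        ¬ Spurious K q τ) := by
  classical
  constructor
  · rintro ⟨σ, hσ, h⟩
    exact ⟨fun v => δ (σ v), fun v hv => congrArg δ (hσ v hv), h.holdsD, h.not_spurious hσ⟩
  · rintro ⟨τ, hτ, h, hsp⟩
    simp only [Spurious, not_or] at hsp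
    obtain ⟨-, hsim, hcyc⟩ := hsp
    have hsim : ∀ s t, Sim K q τ s t → DM K (.eq (evalD τ s) (evalD τ t)) :=
      fun s t hst => by_contra fun hn => hsim ⟨s, t, hst, hn⟩
    by_cases hI : IsEmpty Ind
    · refine ⟨fun v => .ind (π v), fun _ _ => rfl, fun a _ => ?_⟩
      have hT : QTerm V Ind → False
        | .var v => hI.false (π v)
        | .const b => hI.false b
      rcases a with ⟨_, t⟩ | ⟨_, t, _⟩ <;> exact (hT t).elim
    obtain ⟨a0⟩ := not_isEmpty_iff.1 hI
    have hL : ∀ u, ∃ w, Liftable K u → Good K w ∧ δ w = u := fun u => by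
      by_cases hu : Liftable K u
      · exact hu.imp fun w hw _ => hw
      · cases u with
        | ind a => exact ⟨.ind a, fun hu' => absurd hu' hu⟩
        | aux S A => exact ⟨.fn S A (.ind a0), fun hu' => absurd hu' hu⟩
    choose L hL using hL
    have hσ : ∀ v, ∃ w : XTerm C R Ind, (q.answers v → w = .ind (π v)) ∧
        (.var v ∈ q.terms → Realises K q τ L (.var v) w) := fun v => by
      by_cases hm : .var v ∈ q.terms
      · by_cases hv : q.answers v
        · refine ⟨_, fun _ => rfl, fun _ => .named ?_⟩
          have hr := h.eq_self hm
          have e : evalD τ (.var v) = .ind (π v) := hτ v hv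
          rwa [e] at hr ⊢
        · obtain ⟨w, hw⟩ := Realises.exists (L := L) h hcyc hm
          exact ⟨w, fun hv' => absurd hv' hv, fun _ => hw⟩
      · exact ⟨_, fun _ => rfl, fun hm' => absurd hm' hm⟩
    choose σ hσ using hσ
    refine ⟨σ, fun v => (hσ v).1, Realises.holdsX h hsim hL fun t ht => ?_⟩
    cases t with
    | var v => exact (hσ v).2 ht
    | const a => exact .named (h.eq_self ht)

end ELHO
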